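/- Z₀ and the center Z of 𝓛(ε) are integral domains with Z₀ ⊆ Z, and the field embedding of fraction fields Q(Z₀) → Q(Z) induced by this inclusion makes Q(Z) a field extension of Q(Z₀) of degree exactly l, i.e. [Q(Z) : Q(Z₀)] = l. -/

import Mathlib

set_option synthInstance.maxHeartbeats 1000000

noncomputable section

variable (R : Type*) [CommRing R]

/-- Generators. -/
def gA : FreeAlgebra R (Fin 4) := FreeAlgebra.ι R 0
def gB : FreeAlgebra R (Fin 4) := FreeAlgebra.ι R 1
def gC : FreeAlgebra R (Fin 4) := FreeAlgebra.ι R 2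
def gD : FreeAlgebra R (Fin 4) := FreeAlgebra.ι R 3

/-- Defining relations of 𝓛₀,₁, with `s` standing for `q²` and `t` for `q⁻²`. -/
inductive LRel (s t : R) : FreeAlgebra R (Fin 4) → FreeAlgebra R (Fin 4) → Prop
  | rel1 : LRel s t (gA R * gD R) (gD R * gA R)
  | rel2 : LRel s t (gA R * gB R - gB R * gA R)
      (-(algebraMap R (FreeAlgebra R (Fin 4)) (1 - t) * (gB R * gD R)))
  | rel3 : LRel s t (gD R * gB R) (algebraMap R (FreeAlgebra R (Fin 4)) s * (gB R * gD R))
  | rel4 : LRel s t (gC R * gB R - gB R * gC R)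
      (algebraMap R (FreeAlgebra R (Fin 4)) (1 - t) * (gD R * gA R - gD R * gD R))
  | rel5 : LRel s t (gC R * gD R) (algebraMap R (FreeAlgebra R (Fin 4)) s * (gD R * gC R))
  | rel6 : LRel s t (gA R * gC R - gC R * gA R)
      (algebraMap R (FreeAlgebra R (Fin 4)) (1 - t) * (gD R * gC R))
  | rel7 : LRel s t (gA R * gD R - algebraMap R (FreeAlgebra R (Fin 4)) s * (gB R * gC R)) 1

/-- The quantum loop algebra with parameters `s = q²`, `t = q⁻²`. -/
def QLoop (s t : R) : Type _ := RingQuot (LRel R s t)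

instance (s t : R) : Ring (QLoop R s t) := RingQuot.instRing _
instance (s t : R) : Algebra R (QLoop R s t) := RingQuot.instAlgebra _

/-- The generators a, b, c, d of the quantum loop algebra. -/
def qa (s t : R) : QLoop R s t := RingQuot.mkAlgHom R (LRel R s t) (gA R)
def qb (s t : R) : QLoop R s t := RingQuot.mkAlgHom R (LRel R s t) (gB R)
def qc (s t : R) : QLoop R s t := RingQuot.mkAlgHom R (LRel R s t) (gC R)
def qd (s t : R) : QLoop R s t := RingQuot.mkAlgHom R (LRel R s t) (gD R)

/-- The specialization 𝓛(q₀) at q = q₀ ∈ ℂ. -/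
def Lspec (q₀ : ℂ) : Type := QLoop ℂ (q₀ ^ 2) ((q₀ ^ 2)⁻¹)

instance (q₀ : ℂ) : Ring (Lspec q₀) := inferInstanceAs (Ring (QLoop ℂ _ _))
instance (q₀ : ℂ) : Algebra ℂ (Lspec q₀) := inferInstanceAs (Algebra ℂ (QLoop ℂ _ _))


/-- The generators a, b, c, d of 𝓛(q₀). -/
def la (q₀ : ℂ) : Lspec q₀ := qa ℂ (q₀ ^ 2) ((q₀ ^ 2)⁻¹)
def lb (q₀ : ℂ) : Lspec q₀ := qb ℂ (q₀ ^ 2) ((q₀ ^ 2)⁻¹)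
def lc (q₀ : ℂ) : Lspec q₀ := qc ℂ (q₀ ^ 2) ((q₀ ^ 2)⁻¹)
def ld (q₀ : ℂ) : Lspec q₀ := qd ℂ (q₀ ^ 2) ((q₀ ^ 2)⁻¹)

/-- The central element ω := q₀·a + q₀⁻¹·d of 𝓛(q₀). -/
def omegaL (q₀ : ℂ) : Lspec q₀ :=
  algebraMap ℂ (Lspec q₀) q₀ * la q₀ + algebraMap ℂ (Lspec q₀) q₀⁻¹ * ld q₀

set_option maxHeartbeats 1000000

/-- The center of 𝓛(q₀) is a ℂ-algebra. -/
noncomputable instance centerAlgebra (q₀ : ℂ) : Algebra ℂ (Subring.center (Lspec q₀)) :=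
  RingHom.toAlgebra
    ((algebraMap ℂ (Lspec q₀)).codRestrict (Subring.center (Lspec q₀))
      (fun z => Subring.mem_center_iff.mpr fun g => (Algebra.commutes z g).symm))

/-- The copy of `Z₀` inside the center `Z` of 𝓛(ε): the ℂ-subalgebra of `Z` generated by the
four given central elements. -/
noncomputable def Z0inC (ε : ℂ) (x1 x2 x3 x4 : Subring.center (Lspec ε)) :
    Subalgebra ℂ (Subring.center (Lspec ε)) :=
  Algebra.adjoin ℂ {x1, x2, x3, x4}

/-! ### Polynomials and fraction fields -/

open Polynomial in
theorem exists_chebyshev_pair (n : ℕ) : ∃ p r : ℂ[X], p.natDegree ≤ n ∧ r.Monic ∧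
    r.natDegree = n + 1 ∧ (∀ u : ℂ, u ≠ 0 → p.eval (u + u⁻¹) = u ^ n + u⁻¹ ^ n) ∧
    ∀ u : ℂ, u ≠ 0 → r.eval (u + u⁻¹) = u ^ (n + 1) + u⁻¹ ^ (n + 1) := by
  induction n with
  | zero => exact ⟨2, X, by simp, monic_X, by simp, fun u _ => by norm_num, fun u _ => by simp⟩
  | succ n ih =>
    obtain ⟨p, r, hp, hr, hrd, hpe, hre⟩ := ih
    have hXr : (X * r).Monic := monic_X.mul hr
    have hXd : (X * r).natDegree = n + 2 := by
      rw [monic_X.natDegree_mul hr, hrd, natDegree_X]; ring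
    have hlt : p.degree < (X * r).degree := by
      rw [degree_eq_natDegree hXr.ne_zero, hXd]
      exact (degree_le_natDegree).trans_lt (by exact_mod_cast (by omega : p.natDegree < n + 2))
    refine ⟨r, X * r - p, hrd.le, hXr.sub_of_left hlt, ?_, hre, fun u hu => ?_⟩
    · rw [natDegree_eq_of_degree_eq (degree_sub_eq_left_of_degree_lt hlt), hXd]
    · have : u * u⁻¹ = 1 := mul_inv_cancel₀ hu
      rw [eval_sub, eval_mul, eval_X, hpe u hu, hre u hu]
      linear_combination (u ^ n + u⁻¹ ^ n) * this

theorem exists_add_inv_eq (x : ℂ) : ∃ u : ℂ, u ≠ 0 ∧ u + u⁻¹ = x := by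
  obtain ⟨s, hs⟩ := IsAlgClosed.exists_pow_nat_eq (x ^ 2 - 4) (n := 2) (by norm_num)
  have h : (x + s) / 2 * ((x - s) / 2) = 1 := by linear_combination -hs / 4
  refine ⟨(x + s) / 2, left_ne_zero_of_mul_eq_one h, ?_⟩
  rw [← eq_inv_of_mul_eq_one_right h]
  ring

open Polynomial in
theorem map_monic_of_eval_add_inv (l : ℕ) (hl : 0 < l) (P : ℤ[X])
    (hP : ∀ u : ℂ, u ≠ 0 → aeval (u + u⁻¹) P = u ^ l + u⁻¹ ^ l) :
    (P.map (Int.castRingHom ℂ)).Monic ∧ (P.map (Int.castRingHom ℂ)).natDegree = l := by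
  obtain ⟨n, rfl⟩ := Nat.exists_eq_succ_of_ne_zero hl.ne'
  obtain ⟨-, r, -, hr, hrd, -, hre⟩ := exists_chebyshev_pair n
  have : P.map (Int.castRingHom ℂ) = r := by
    refine Polynomial.funext fun x => ?_
    obtain ⟨u, hu, rfl⟩ := exists_add_inv_eq x
    rw [hre u hu, ← Nat.succ_eq_add_one, ← hP u hu, eval_map, aeval_def]
    rfl
  rw [this]
  exact ⟨hr, hrd⟩

/-- Powers of `X` below the degree of `p` are independent over `ℂ[p]`. -/
theorem eq_zero_of_sum_comp_mul_X_pow {p : Polynomial ℂ} {l : ℕ} (hl : 0 < l)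
    (hp : p.natDegree = l) (w : ℕ → Polynomial ℂ)
    (h : ∑ i ∈ Finset.range l, (w i).comp p * Polynomial.X ^ i = 0) :
    ∀ i < l, w i = 0 := by
  have hcomp : ∀ i, w i ≠ 0 → (w i).comp p ≠ 0 := fun i hi h0 => by
    rcases Polynomial.comp_eq_zero_iff.mp h0 with h1 | ⟨-, h1⟩
    · exact hi h1
    · rw [h1, Polynomial.natDegree_C] at hp; omega
  have hne : ∀ i, (w i).comp p * Polynomial.X ^ i ≠ 0 → w i ≠ 0 := fun i hi h0 => by
    simp [h0] at hi
  have hdeg : ∀ i, w i ≠ 0 → ((w i).comp p * Polynomial.X ^ i).degree =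
      (((w i).natDegree * l + i : ℕ) : WithBot ℕ) := fun i hi => by
    have := hcomp i hi
    rw [Polynomial.degree_eq_natDegree (mul_ne_zero this (pow_ne_zero _ Polynomial.X_ne_zero)),
      Polynomial.natDegree_mul this (pow_ne_zero _ Polynomial.X_ne_zero),
      Polynomial.natDegree_X_pow, Polynomial.natDegree_comp, hp]
  have key := Polynomial.degree_sum_eq_of_disjoint
    (fun i => (w i).comp p * Polynomial.X ^ i) (Finset.range l) ?_
  · intro i hi
    by_contra hw
    rw [h, Polynomial.degree_zero, eq_comm, Finset.sup_eq_bot_iff] at key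
    have := key i (Finset.mem_range.mpr hi)
    rw [hdeg i hw] at this
    exact WithBot.natCast_ne_bot _ this
  · rintro i ⟨hi, hi'⟩ j ⟨hj, hj'⟩ hij heq
    simp only [Function.comp_apply] at heq
    rw [hdeg i (hne i hi'), hdeg j (hne j hj')] at heq
    have heq := congrArg (· % l) (WithBot.coe_injective heq)
    simp only [Nat.mul_add_mod_self_right, Nat.cast_id] at heq
    rw [Nat.mod_eq_of_lt (Finset.mem_range.mp hi), Nat.mod_eq_of_lt (Finset.mem_range.mp hj)] at heq
    exact hij heq

/-- If `S` is free over `R` with basis `1, x, …, x ^ (l - 1)`, the fraction field of `S` has degree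
`l` over that of `R`. -/
theorem exists_finrank_fractionRing_eq {R S : Type} [CommRing R] [IsDomain R] [CommRing S]
    [IsDomain S] [Algebra R S] [FaithfulSMul R S] (l : ℕ) (x : S)
    (hli : LinearIndependent R (fun i : Fin l => x ^ (i : ℕ)))
    (hspan : ⊤ ≤ Submodule.span R (Set.range (fun i : Fin l => x ^ (i : ℕ)))) :
    ∃ f : FractionRing R →+* FractionRing S,
      f.comp (algebraMap _ _) = (algebraMap S (FractionRing S)).comp (algebraMap R S) ∧
      @Module.finrank (FractionRing R) (FractionRing S) _ _ (Module.compHom _ f) = l := by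
  have hfin : Module.Finite R S := .of_basis (Module.Basis.mk hli hspan)
  let : Algebra (FractionRing R) (FractionRing S) := FractionRing.liftAlgebra R _
  have hST : IsScalarTower R (FractionRing R) (FractionRing S) :=
    FractionRing.isScalarTower_liftAlgebra R _
  refine ⟨algebraMap _ _, ?_, ?_⟩
  · rw [← IsScalarTower.algebraMap_eq, ← IsScalarTower.algebraMap_eq]
  · rw [show Module.compHom (FractionRing S) (algebraMap (FractionRing R) (FractionRing S)) =
      Algebra.toModule from Module.ext' _ _ fun r s => (Algebra.smul_def r s).symm]
    rw [IsFractionRing.finrank_eq R (FractionRing R) S (FractionRing S),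
      Module.finrank_eq_card_basis (Module.Basis.mk hli hspan), Fintype.card_fin]

/-- If `S` is generated over `R` by a root of a monic polynomial of degree `l`, the powers of that
root below `l` span. -/
theorem top_le_span_pow_of_monic {R S : Type} [CommRing R] [CommRing S] [Algebra R S] (l : ℕ)
    (hl0 : 0 < l) (x : S) (p : Polynomial R) (hp : p.Monic) (hl : p.natDegree = l)
    (hx : Polynomial.aeval x p = 0)
    (hadj : Algebra.adjoin R {x} = ⊤) :
    ⊤ ≤ Submodule.span R (Set.range (fun i : Fin l => x ^ (i : ℕ))) := by
  nontriviality R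
  intro y _
  have hy : y ∈ Algebra.adjoin R {x} := hadj ▸ Algebra.mem_top
  rw [Algebra.adjoin_singleton_eq_range_aeval] at hy
  obtain ⟨r, rfl⟩ := hy
  rw [← Polynomial.modByMonic_add_div r p]
  simp only [AlgHom.toRingHom_eq_coe, RingHom.coe_coe, map_add, map_mul, hx, zero_mul, add_zero]
  rw [Polynomial.aeval_eq_sum_range' (n := l)]
  · exact Submodule.sum_mem _ fun i hi => Submodule.smul_mem _ _
      (Submodule.subset_span ⟨⟨i, Finset.mem_range.mp hi⟩, rfl⟩)
  · rw [← hl]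
    exact Polynomial.natDegree_modByMonic_lt r hp fun h1 => by
      rw [h1, Polynomial.natDegree_one] at hl
      omega

section PolynomialModel

open Polynomial

/-! ### Consequences of the relations -/

section Relations

variable (q : ℂ)

/-- The quotient map from the free algebra onto `𝓛(q)`. -/
def lspecMk : FreeAlgebra ℂ (Fin 4) →ₐ[ℂ] Lspec q :=
  RingQuot.mkAlgHom ℂ (LRel ℂ (q ^ 2) (q ^ 2)⁻¹)

theorem lspecMk_surjective : Function.Surjective (lspecMk q) :=
  RingQuot.mkAlgHom_surjective ℂ _

theorem lspecMk_gA : lspecMk q (gA ℂ) = la q := rfl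
theorem lspecMk_gB : lspecMk q (gB ℂ) = lb q := rfl
theorem lspecMk_gC : lspecMk q (gC ℂ) = lc q := rfl
theorem lspecMk_gD : lspecMk q (gD ℂ) = ld q := rfl

theorem lspecMk_rel {x y : FreeAlgebra ℂ (Fin 4)} (h : LRel ℂ (q ^ 2) (q ^ 2)⁻¹ x y) :
    lspecMk q x = lspecMk q y :=
  RingQuot.mkAlgHom_rel ℂ h

theorem adjoin_generators : Algebra.adjoin ℂ {la q, lb q, lc q, ld q} = ⊤ := by
  have h := congrArg (Subalgebra.map (lspecMk q)) (FreeAlgebra.adjoin_range_ι ℂ (Fin 4))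
  rw [AlgHom.map_adjoin, Algebra.map_top,
    (AlgHom.range_eq_top _).mpr (lspecMk_surjective q), ← Set.range_comp] at h
  rw [← h]
  congr 1
  ext x
  simp only [Set.mem_insert_iff, Set.mem_singleton_iff, Set.mem_range, Fin.exists_fin_succ,
    Function.comp_apply, eq_comm (b := x)]
  simp [← lspecMk_gA, ← lspecMk_gB, ← lspecMk_gC, ← lspecMk_gD, gA, gB, gC, gD]

variable {q}

theorem la_mul_ld : la q * ld q = ld q * la q := by
  simpa only [map_mul] using! lspecMk_rel q .rel1

theorem la_mul_lb : la q * lb q - lb q * la q = -((1 - (q ^ 2)⁻¹) • (lb q * ld q)) := by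
  rw [Algebra.smul_def]
  simpa only [map_mul, map_sub, map_neg, AlgHom.commutes] using! lspecMk_rel q .rel2

theorem ld_mul_lb : ld q * lb q = q ^ 2 • (lb q * ld q) := by
  rw [Algebra.smul_def]
  simpa only [map_mul, map_sub, map_neg, AlgHom.commutes] using! lspecMk_rel q .rel3

theorem lc_mul_lb : lc q * lb q - lb q * lc q =
    (1 - (q ^ 2)⁻¹) • (ld q * la q - ld q * ld q) := by
  rw [Algebra.smul_def]
  simpa only [map_mul, map_sub, map_neg, AlgHom.commutes] using! lspecMk_rel q .rel4

theorem lc_mul_ld : lc q * ld q = q ^ 2 • (ld q * lc q) := by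
  rw [Algebra.smul_def]
  simpa only [map_mul, map_sub, map_neg, AlgHom.commutes] using! lspecMk_rel q .rel5

theorem la_mul_lc : la q * lc q - lc q * la q = (1 - (q ^ 2)⁻¹) • (ld q * lc q) := by
  rw [Algebra.smul_def]
  simpa only [map_mul, map_sub, map_neg, AlgHom.commutes] using! lspecMk_rel q .rel6

theorem la_mul_ld_sub : la q * ld q - q ^ 2 • (lb q * lc q) = 1 := by
  rw [Algebra.smul_def]
  simpa only [map_mul, map_sub, map_one, AlgHom.commutes] using! lspecMk_rel q .rel7

theorem omegaL_eq : omegaL q = q • la q + q⁻¹ • ld q := by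
  rw [omegaL, Algebra.smul_def, Algebra.smul_def]

theorem la_eq (hq : q ≠ 0) : la q = q⁻¹ • omegaL q - (q ^ 2)⁻¹ • ld q := by
  rw [omegaL_eq]
  match_scalars <;> field_simp
  ring

theorem mem_center_of_commute {z : Lspec q} (ha : Commute z (la q)) (hb : Commute z (lb q))
    (hc : Commute z (lc q)) (hd : Commute z (ld q)) : z ∈ Subring.center (Lspec q) := by
  have h : Algebra.adjoin ℂ {la q, lb q, lc q, ld q} ≤ Subalgebra.centralizer ℂ {z} := by
    refine Algebra.adjoin_le ?_
    rintro x (rfl | rfl | rfl | rfl) _ rfl <;> assumption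
  rw [adjoin_generators] at h
  refine Subring.mem_center_iff.mpr fun g => ?_
  have := Subalgebra.mem_centralizer_iff ℂ |>.mp (h (Algebra.mem_top (x := g))) z rfl
  exact this.symm

theorem omegaL_mem_center (hq : q ≠ 0) : omegaL q ∈ Subring.center (Lspec q) := by
  rw [omegaL_eq]
  refine mem_center_of_commute ?_ ?_ ?_ ?_
  · exact ((Commute.refl _).smul_left _).add_left
      ((show Commute _ _ from la_mul_ld).symm.smul_left _)
  · have h := la_mul_lb (q := q)
    rw [sub_eq_iff_eq_add] at h
    simp only [Commute, SemiconjBy, add_mul, mul_add, smul_mul_assoc, mul_smul_comm, h, ld_mul_lb]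
    match_scalars <;> field_simp
    ring
  · have h := la_mul_lc (q := q)
    rw [sub_eq_iff_eq_add] at h
    simp only [Commute, SemiconjBy, add_mul, mul_add, smul_mul_assoc, mul_smul_comm, h, lc_mul_ld]
    match_scalars <;> field_simp
    ring
  · exact ((show Commute _ _ from la_mul_ld).smul_left _).add_left ((Commute.refl _).smul_left _)

theorem mem_center_of_commute' (hq : q ≠ 0) {z : Lspec q} (hb : Commute z (lb q))
    (hc : Commute z (lc q)) (hd : Commute z (ld q)) : z ∈ Subring.center (Lspec q) := by
  refine mem_center_of_commute ?_ hb hc hd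
  rw [la_eq hq]
  exact (Commute.smul_right (Subring.mem_center_iff.mp (omegaL_mem_center hq) z) _).sub_right
    (hd.smul_right _)

theorem ld_mul_lc (hq : q ≠ 0) : ld q * lc q = (q ^ 2)⁻¹ • (lc q * ld q) := by
  rw [lc_mul_ld, smul_smul, inv_mul_cancel₀ (pow_ne_zero 2 hq), one_smul]

end Relations

section Evaluation

variable {q : ℂ}

/-- The subalgebra `ℂ[ω, d]` of `𝓛(q)`, as the image of a polynomial ring. -/
def evalOmegaD (hq : q ≠ 0) : ℂ[X][X] →+* Lspec q :=
  eval₂RingHom' (aeval (omegaL q)).toRingHom (ld q) fun p => by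
    have : aeval (omegaL q) p ∈ Subalgebra.centralizer ℂ {ld q} := by
      refine Algebra.adjoin_le (S := Subalgebra.centralizer ℂ {ld q}) ?_
        (aeval_mem_adjoin_singleton ℂ (omegaL q) (p := p))
      rintro _ rfl _ rfl
      exact Subring.mem_center_iff.mp (omegaL_mem_center hq) (ld q)
    exact (Subalgebra.mem_centralizer_iff ℂ |>.mp this (ld q) rfl).symm

variable (hq : q ≠ 0)

theorem evalOmegaD_X : evalOmegaD hq X = ld q := by
  simp [evalOmegaD, eval₂RingHom']

theorem evalOmegaD_C (p : ℂ[X]) : evalOmegaD hq (C p) = aeval (omegaL q) p := by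
  simp [evalOmegaD, eval₂RingHom']

theorem evalOmegaD_smul (z : ℂ) (p : ℂ[X][X]) : evalOmegaD hq (z • p) = z • evalOmegaD hq p := by
  rw [Algebra.smul_def, Algebra.smul_def, map_mul, Polynomial.algebraMap_apply, evalOmegaD_C,
    Polynomial.algebraMap_apply, aeval_C]
  rfl

/-- `b c = structPoly d` and `c b = structPoly (q² d)` in `𝓛(q)`. -/
def structPoly (q : ℂ) (y : ℂ[X][X]) : ℂ[X][X] :=
  (q ^ 3)⁻¹ • (C X * y) - (q ^ 4)⁻¹ • y ^ 2 - C (C (q ^ 2)⁻¹)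

theorem lb_mul_lc : lb q * lc q = evalOmegaD hq (structPoly q X) := by
  have h := la_mul_ld_sub (q := q)
  rw [la_eq hq] at h
  have h2 : lb q * lc q = (q ^ 2)⁻¹ • ((q⁻¹ • omegaL q - (q ^ 2)⁻¹ • ld q) * ld q - 1) := by
    rw [← h]; simp [smul_smul, hq]
  rw [h2, structPoly]
  simp only [map_sub, evalOmegaD_smul, map_mul, map_pow, evalOmegaD_C, evalOmegaD_X, aeval_X,
    aeval_C, sub_mul, smul_mul_assoc, Algebra.algebraMap_eq_smul_one, pow_two (ld q)]
  match_scalars <;> field_simp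

theorem lc_mul_lb_eq : lc q * lb q = evalOmegaD hq (structPoly q (q ^ 2 • X)) := by
  have h := lc_mul_lb (q := q)
  rw [sub_eq_iff_eq_add, lb_mul_lc hq, la_eq hq] at h
  have hc : ld q * omegaL q = omegaL q * ld q :=
    Subring.mem_center_iff.mp (omegaL_mem_center hq) (ld q)
  rw [h, structPoly, structPoly]
  simp only [map_sub, evalOmegaD_smul, map_mul, map_pow, evalOmegaD_C, evalOmegaD_X, aeval_X,
    aeval_C, mul_sub, mul_smul_comm, Algebra.algebraMap_eq_smul_one,
    pow_two (ld q), hc, _root_.smul_pow]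
  match_scalars <;> field_simp <;> ring

end Evaluation

/-! ### A representation on Laurent polynomials -/

section Representation

/-- Laurent polynomials over `ℂ[ω][d]`. -/
abbrev LaurentOmegaD : Type := LaurentPolynomial ℂ[X][X]

/-- The basis of Laurent polynomials given by the powers of `T`. -/
def laurentBasis : Module.Basis ℤ ℂ[X][X] LaurentOmegaD :=
  ⟨AddMonoidAlgebra.coeffLinearEquiv ℂ[X][X]⟩

theorem laurentBasis_apply (n : ℤ) : laurentBasis n = LaurentPolynomial.T n := by
  rfl

/-- The weighted shift `T n ↦ g n • T (n + k)`. -/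
def weightedShift (g : ℤ → ℂ[X][X]) (k : ℤ) : Module.End ℂ[X][X] LaurentOmegaD :=
  laurentBasis.constr ℕ fun n => g n • LaurentPolynomial.T (n + k)

theorem weightedShift_T (g : ℤ → ℂ[X][X]) (k n : ℤ) :
    weightedShift g k (LaurentPolynomial.T n) = g n • LaurentPolynomial.T (n + k) := by
  rw [weightedShift, ← laurentBasis_apply, Module.Basis.constr_basis]

theorem end_ext {f g : Module.End ℂ[X][X] LaurentOmegaD}
    (h : ∀ n, f (LaurentPolynomial.T n) = g (LaurentPolynomial.T n)) : f = g :=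
  laurentBasis.ext h

variable (q : ℂ)

/-- The weight `q⁻²ⁿ d` of `d` on `T n`. -/
def weightD (n : ℤ) : ℂ[X][X] := (q ^ 2)⁻¹ ^ n • X

/-- The images of `a, b, c, d` in the representation on Laurent polynomials. -/
def repGen : Fin 4 → Module.End ℂ[X][X] LaurentOmegaD :=
  ![weightedShift (fun n => q⁻¹ • C X - (q ^ 2)⁻¹ • weightD q n) 0,
    weightedShift (fun n => structPoly q (weightD q (n - 1))) (-1),
    weightedShift 1 1, weightedShift (weightD q) 0]

variable {q}

theorem weightD_succ (hq : q ≠ 0) (n : ℤ) : weightD q (n + 1) = (q ^ 2)⁻¹ • weightD q n := by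
  rw [weightD, weightD, zpow_add_one₀ (inv_ne_zero (pow_ne_zero 2 hq)), smul_smul, mul_comm]

theorem weightD_pred (hq : q ≠ 0) (n : ℤ) : weightD q (n - 1) = q ^ 2 • weightD q n := by
  obtain ⟨m, rfl⟩ : ∃ m, n = m + 1 := ⟨n - 1, by ring⟩
  rw [weightD_succ hq, add_sub_cancel_right, smul_smul, mul_inv_cancel₀ (pow_ne_zero 2 hq),
    one_smul]

theorem complex_smul_eq (z : ℂ) (p : ℂ[X][X]) : z • p = C (C z) * p := by
  rw [Algebra.smul_def]
  rfl

theorem complex_smul_laurent (z : ℂ) (v : LaurentOmegaD) : z • v = (C (C z) : ℂ[X][X]) • v := by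
  rw [← mul_one (C (C z)), ← complex_smul_eq, smul_assoc, one_smul]

theorem lift_gA_T (n : ℤ) : FreeAlgebra.lift ℂ (repGen q) (gA ℂ) (LaurentPolynomial.T n) =
    (q⁻¹ • C X - (q ^ 2)⁻¹ • weightD q n) • LaurentPolynomial.T n := by
  rw [gA, FreeAlgebra.lift_ι_apply]
  exact (weightedShift_T _ 0 n).trans (by rw [add_zero])

theorem lift_gB_T (n : ℤ) : FreeAlgebra.lift ℂ (repGen q) (gB ℂ) (LaurentPolynomial.T n) =
    structPoly q (weightD q (n - 1)) • LaurentPolynomial.T (n - 1) := by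
  rw [gB, FreeAlgebra.lift_ι_apply]
  exact weightedShift_T _ (-1) n

theorem lift_gC_T (n : ℤ) : FreeAlgebra.lift ℂ (repGen q) (gC ℂ) (LaurentPolynomial.T n) =
    LaurentPolynomial.T (n + 1) := by
  rw [gC, FreeAlgebra.lift_ι_apply]
  exact (weightedShift_T 1 1 n).trans (by rw [Pi.one_apply, one_smul])

theorem lift_gD_T (n : ℤ) : FreeAlgebra.lift ℂ (repGen q) (gD ℂ) (LaurentPolynomial.T n) =
    weightD q n • LaurentPolynomial.T n := by
  rw [gD, FreeAlgebra.lift_ι_apply]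
  exact (weightedShift_T _ 0 n).trans (by rw [add_zero])

theorem lift_sub_apply (f : FreeAlgebra ℂ (Fin 4) →ₐ[ℂ] Module.End ℂ[X][X] LaurentOmegaD)
    (x y : FreeAlgebra ℂ (Fin 4)) (v : LaurentOmegaD) : f (x - y) v = f x v - f y v := by
  rw [eq_sub_iff_add_eq, ← LinearMap.add_apply, ← map_add, sub_add_cancel]

theorem lift_neg_apply (f : FreeAlgebra ℂ (Fin 4) →ₐ[ℂ] Module.End ℂ[X][X] LaurentOmegaD)
    (x : FreeAlgebra ℂ (Fin 4)) (v : LaurentOmegaD) : f (-x) v = -f x v := by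
  rw [eq_neg_iff_add_eq_zero, ← LinearMap.add_apply, ← map_add, neg_add_cancel, map_zero,
    LinearMap.zero_apply]

theorem lift_mul_apply (f : FreeAlgebra ℂ (Fin 4) →ₐ[ℂ] Module.End ℂ[X][X] LaurentOmegaD)
    (x y : FreeAlgebra ℂ (Fin 4)) (v : LaurentOmegaD) : f (x * y) v = f x (f y v) := by
  rw [map_mul, Module.End.mul_apply]

theorem lift_algebraMap_apply
    (f : FreeAlgebra ℂ (Fin 4) →ₐ[ℂ] Module.End ℂ[X][X] LaurentOmegaD)
    (z : ℂ) (v : LaurentOmegaD) :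
    f (algebraMap ℂ _ z) v = (C (C z) : ℂ[X][X]) • v := by
  rw [show f (algebraMap ℂ _ z) = algebraMap ℂ _ z from f.commutes z,
    Module.algebraMap_end_apply, complex_smul_laurent]

theorem lift_repGen_rel (hq : q ≠ 0) {x y : FreeAlgebra ℂ (Fin 4)}
    (h : LRel ℂ (q ^ 2) (q ^ 2)⁻¹ x y) :
    FreeAlgebra.lift ℂ (repGen q) x = FreeAlgebra.lift ℂ (repGen q) y := by
  have hQ : (C (C q) : ℂ[X][X]) * C (C q⁻¹) = 1 := by
    rw [← C_mul, ← C_mul, mul_inv_cancel₀ hq, C_1, C_1]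
  refine end_ext fun n => ?_
  have hs (n : ℤ) := weightD_succ hq n
  have hp (n : ℤ) := weightD_pred hq n
  induction h <;>
  simp only [lift_sub_apply, lift_neg_apply, lift_mul_apply, lift_algebraMap_apply, map_one,
    Module.End.one_apply,
    lift_gA_T, lift_gB_T, lift_gC_T, lift_gD_T, map_smul, smul_smul,
    hs, hp, structPoly, complex_smul_eq, add_sub_cancel_right, sub_add_cancel] <;>
  generalize weightD q n = y <;>
  simp only [C_sub, C_pow, C_1, ← inv_pow] <;>
  generalize hu : (C (C q) : ℂ[X][X]) = u at * <;>
  generalize (C (C q⁻¹) : ℂ[X][X]) = v at *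
  all_goals
    match_scalars
    grind

/-- The representation of `𝓛(q)` on Laurent polynomials over `ℂ[ω][d]`. -/
def laurentRep (hq : q ≠ 0) : Lspec q →ₐ[ℂ] Module.End ℂ[X][X] LaurentOmegaD :=
  RingQuot.liftAlgHom ℂ ⟨FreeAlgebra.lift ℂ (repGen q), fun _ _ h => lift_repGen_rel hq h⟩

theorem laurentRep_mk (hq : q ≠ 0) (x : FreeAlgebra ℂ (Fin 4)) :
    laurentRep hq (lspecMk q x) = FreeAlgebra.lift ℂ (repGen q) x :=
  RingQuot.liftAlgHom_mkAlgHom_apply ..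

variable (hq : q ≠ 0)

theorem laurentRep_la_T (n : ℤ) : laurentRep hq (la q) (LaurentPolynomial.T n) =
    (q⁻¹ • C X - (q ^ 2)⁻¹ • weightD q n) • LaurentPolynomial.T n := by
  rw [← lspecMk_gA, laurentRep_mk, lift_gA_T]

theorem laurentRep_lb_T (n : ℤ) : laurentRep hq (lb q) (LaurentPolynomial.T n) =
    structPoly q (weightD q (n - 1)) • LaurentPolynomial.T (n - 1) := by
  rw [← lspecMk_gB, laurentRep_mk, lift_gB_T]

theorem laurentRep_lc_T (n : ℤ) : laurentRep hq (lc q) (LaurentPolynomial.T n) =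
    LaurentPolynomial.T (n + 1) := by
  rw [← lspecMk_gC, laurentRep_mk, lift_gC_T]

theorem laurentRep_ld_T (n : ℤ) : laurentRep hq (ld q) (LaurentPolynomial.T n) =
    weightD q n • LaurentPolynomial.T n := by
  rw [← lspecMk_gD, laurentRep_mk, lift_gD_T]

theorem laurentRep_omegaL : laurentRep hq (omegaL q) = (C X : ℂ[X][X]) • 1 := by
  refine end_ext fun n => ?_
  rw [omegaL_eq, map_add, map_smul, map_smul, LinearMap.add_apply, LinearMap.smul_apply,
    LinearMap.smul_apply, laurentRep_la_T, laurentRep_ld_T, LinearMap.smul_apply,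
    Module.End.one_apply]
  rw [← smul_assoc, ← smul_assoc, ← add_smul]
  congr 1
  match_scalars <;> field_simp
  ring

end Representation

/-! ### Normal form and faithfulness -/

section NormalForm

theorem mul_pow_of_mul_eq_smul {A : Type*} [Ring A] [Algebra ℂ A] {x y : A} {z : ℂ}
    (h : x * y = z • (y * x)) (n : ℕ) : x * y ^ n = z ^ n • (y ^ n * x) := by
  induction n with
  | zero => simp
  | succ n ih =>
    rw [pow_succ, ← mul_assoc, ih, smul_mul_assoc, mul_assoc, h, mul_smul_comm, smul_smul,
      ← mul_assoc, ← pow_succ]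

variable (q : ℂ)

/-- The element `cᵏ` for `k ≥ 0`, and `b⁻ᵏ` for `k < 0`. -/
def laurentMon : ℤ → Lspec q
  | .ofNat n => lc q ^ n
  | .negSucc n => lb q ^ (n + 1)

theorem laurentMon_natCast (n : ℕ) : laurentMon q n = lc q ^ n := rfl

theorem laurentMon_neg_natCast (n : ℕ) : laurentMon q (-n) = lb q ^ n := by
  cases n with
  | zero => exact (laurentMon_natCast q 0).trans (by simp)
  | succ n => rfl

variable {q} (hq : q ≠ 0)

include hq in
theorem ld_mul_laurentMon (k : ℤ) :
    ld q * laurentMon q k = (q ^ 2)⁻¹ ^ k • (laurentMon q k * ld q) := by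
  obtain ⟨n, rfl | rfl⟩ := k.eq_nat_or_neg
  · rw [laurentMon_natCast, mul_pow_of_mul_eq_smul (ld_mul_lc hq), zpow_natCast]
  · rw [laurentMon_neg_natCast, mul_pow_of_mul_eq_smul ld_mul_lb, zpow_neg, zpow_natCast, inv_pow,
      inv_inv]

/-- The sum of the elements `laurentMon k * f k(ω, d)`. -/
def normalForm : (ℤ →₀ ℂ[X][X]) →+ Lspec q :=
  Finsupp.liftAddHom fun k =>
    (AddMonoidHom.mulLeft (laurentMon q k)).comp (evalOmegaD hq).toAddMonoidHom

theorem normalForm_single (k : ℤ) (p : ℂ[X][X]) :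
    normalForm hq (.single k p) = laurentMon q k * evalOmegaD hq p := by
  simp [normalForm]

theorem mul_mem_range_normalForm {x : Lspec q}
    (h : ∀ k p, x * (laurentMon q k * evalOmegaD hq p) ∈ AddMonoidHom.mrange (normalForm hq))
    {u : Lspec q}
    (hu : u ∈ AddMonoidHom.mrange (normalForm hq)) :
    x * u ∈ AddMonoidHom.mrange (normalForm hq) := by
  obtain ⟨f, rfl⟩ := hu
  induction f using Finsupp.induction_linear with
  | zero => rw [map_zero, mul_zero]; exact zero_mem _
  | add f g hf hg => rw [map_add, mul_add]; exact add_mem hf hg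
  | single k p => rw [normalForm_single]; exact h k p

theorem evalOmegaD_mul_mem_range (p : ℂ[X][X]) {u : Lspec q}
    (hu : u ∈ AddMonoidHom.mrange (normalForm hq)) :
    evalOmegaD hq p * u ∈ AddMonoidHom.mrange (normalForm hq) := by
  induction p using Polynomial.induction_on' generalizing u with
  | add p r hp hr => rw [map_add, add_mul]; exact add_mem (hp hu) (hr hu)
  | monomial n p =>
    rw [← C_mul_X_pow_eq_monomial, map_mul, map_pow, evalOmegaD_X, mul_assoc]
    have hc : ∀ v ∈ AddMonoidHom.mrange (normalForm hq),
        evalOmegaD hq (C p) * v ∈ AddMonoidHom.mrange (normalForm hq) :=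
      fun v hv => mul_mem_range_normalForm hq (fun k r => by
        have hp : evalOmegaD hq (C p) ∈ Subring.center (Lspec q) := by
          rw [evalOmegaD_C]
          refine Subring.mem_center_iff.mpr fun g => ?_
          have : aeval (omegaL q) p ∈ Subalgebra.centralizer ℂ {g} :=
            Algebra.adjoin_le (S := Subalgebra.centralizer ℂ {g})
              (by
                rintro _ rfl _ rfl
                exact Subring.mem_center_iff.mp (omegaL_mem_center hq) _)
              (aeval_mem_adjoin_singleton ℂ (omegaL q) (p := p))
          exact Subalgebra.mem_centralizer_iff ℂ |>.mp this g rfl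
        refine ⟨.single k (C p * r), ?_⟩
        rw [normalForm_single, map_mul, ← mul_assoc, Subring.mem_center_iff.mp hp, mul_assoc]) hv
    refine hc _ ?_
    induction n with
    | zero => simpa using hu
    | succ n ih =>
      rw [pow_succ', mul_assoc]
      refine mul_mem_range_normalForm hq (fun k r => ?_) ih
      refine ⟨.single k ((q ^ 2)⁻¹ ^ k • (X * r)), ?_⟩
      rw [normalForm_single, evalOmegaD_smul, map_mul, evalOmegaD_X, ← mul_assoc,
        ld_mul_laurentMon hq, mul_smul_comm, smul_mul_assoc, mul_assoc]

theorem laurentMon_mul_mem_range (k : ℤ) (p : ℂ[X][X]) :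
    laurentMon q k * evalOmegaD hq p ∈ AddMonoidHom.mrange (normalForm hq) :=
  ⟨.single k p, normalForm_single hq k p⟩

theorem normalForm_surjective : Function.Surjective (normalForm hq) := by
  have key (x : Lspec q) : ∀ u ∈ AddMonoidHom.mrange (normalForm hq),
      x * u ∈ AddMonoidHom.mrange (normalForm hq) := by
    have hx : x ∈ Algebra.adjoin ℂ {la q, lb q, lc q, ld q} := by
      rw [adjoin_generators]; exact Algebra.mem_top
    have hd : ∀ u ∈ AddMonoidHom.mrange (normalForm hq),
        ld q * u ∈ AddMonoidHom.mrange (normalForm hq) := fun u hu => by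
      rw [← evalOmegaD_X hq]; exact evalOmegaD_mul_mem_range hq _ hu
    induction hx using Algebra.adjoin_induction with
    | algebraMap z =>
      intro u hu
      have := evalOmegaD_mul_mem_range hq (C (C z)) hu
      rwa [evalOmegaD_C, aeval_C] at this
    | add x y _ _ hx hy => intro u hu; rw [add_mul]; exact add_mem (hx u hu) (hy u hu)
    | mul x y _ _ hx hy => intro u hu; rw [mul_assoc]; exact hx _ (hy u hu)
    | mem x hx =>
      rcases hx with rfl | rfl | rfl | rfl
      · intro u hu
        have := evalOmegaD_mul_mem_range hq (q⁻¹ • C X - (q ^ 2)⁻¹ • X) hu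
        rwa [map_sub, evalOmegaD_smul, evalOmegaD_smul, evalOmegaD_X, evalOmegaD_C, aeval_X,
          ← la_eq hq] at this
      · refine fun u => mul_mem_range_normalForm hq fun k p => ?_
        obtain ⟨n, rfl | rfl⟩ := k.eq_nat_or_neg
        · cases n with
          | zero =>
            have := laurentMon_mul_mem_range hq (-(1 : ℕ)) p
            rw [laurentMon_neg_natCast, pow_one] at this
            simpa [laurentMon] using this
          | succ n =>
            rw [laurentMon_natCast, pow_succ', mul_assoc, ← mul_assoc, lb_mul_lc hq]
            exact evalOmegaD_mul_mem_range hq _ (laurentMon_mul_mem_range hq n p)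
        · rw [laurentMon_neg_natCast, ← mul_assoc, ← pow_succ', ← laurentMon_neg_natCast]
          exact laurentMon_mul_mem_range hq _ p
      · refine fun u => mul_mem_range_normalForm hq fun k p => ?_
        obtain ⟨n, rfl | rfl⟩ := k.eq_nat_or_neg
        · rw [laurentMon_natCast, ← mul_assoc, ← pow_succ', ← laurentMon_natCast]
          exact laurentMon_mul_mem_range hq _ p
        · cases n with
          | zero =>
            have := laurentMon_mul_mem_range hq (1 : ℕ) p
            rw [laurentMon_natCast, pow_one] at this
            simpa [laurentMon] using this
          | succ n =>
            rw [laurentMon_neg_natCast, pow_succ', mul_assoc, ← mul_assoc, lc_mul_lb_eq hq,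
              ← laurentMon_neg_natCast]
            exact evalOmegaD_mul_mem_range hq _ (laurentMon_mul_mem_range hq _ p)
      · exact hd
  intro x
  have h1 : (1 : Lspec q) ∈ AddMonoidHom.mrange (normalForm hq) :=
    ⟨.single 0 1, by rw [normalForm_single]; simp [laurentMon]⟩
  simpa using key x 1 h1

end NormalForm

section Faithful

variable {q : ℂ} (hq : q ≠ 0)

theorem laurentRep_evalOmegaD_C (p : ℂ[X]) :
    laurentRep hq (evalOmegaD hq (C p)) = (C p : ℂ[X][X]) • 1 := by
  rw [evalOmegaD_C]
  induction p using Polynomial.induction_on' with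
  | add p r hp hr => 
    refine end_ext fun n => ?_
    rw [map_add, map_add, hp, hr, C_add]
    exact (add_smul (C p) (C r) (LaurentPolynomial.T n : LaurentOmegaD)).symm
  | monomial n z =>
    have h (v : LaurentOmegaD) : laurentRep hq (omegaL q ^ n) v = (C X : ℂ[X][X]) ^ n • v := by
      induction n with
      | zero => simp
      | succ n ih =>
        rw [pow_succ', map_mul, Module.End.mul_apply, ih, laurentRep_omegaL, pow_succ', mul_smul]
        rfl
    refine end_ext fun m => ?_
    rw [← C_mul_X_pow_eq_monomial, map_mul, map_pow, aeval_X, aeval_C, map_mul, AlgHom.commutes,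
      Module.End.mul_apply, h, Module.algebraMap_end_apply, complex_smul_laurent, C_mul, C_pow,
      smul_smul]
    rfl

theorem weightD_zero : weightD q 0 = X := by
  rw [weightD, zpow_zero, one_smul]

theorem laurentRep_ld_pow_T (n : ℤ) (k : ℕ) :
    laurentRep hq (ld q ^ k) (LaurentPolynomial.T n) = weightD q n ^ k • LaurentPolynomial.T n := by
  induction k with
  | zero => simp
  | succ k ih =>
    rw [pow_succ, map_mul, Module.End.mul_apply, laurentRep_ld_T, map_smul, ih, smul_smul,
      pow_succ']

theorem laurentRep_lc_pow_T (n : ℤ) (k : ℕ) :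
    laurentRep hq (lc q ^ k) (LaurentPolynomial.T n) = LaurentPolynomial.T (n + k) := by
  induction k with
  | zero => simp
  | succ k ih =>
    rw [pow_succ', map_mul, Module.End.mul_apply, ih, laurentRep_lc_T, Nat.cast_succ, add_assoc]

theorem laurentRep_lb_pow_T (n : ℤ) (k : ℕ) :
    laurentRep hq (lb q ^ k) (LaurentPolynomial.T n) =
      (∏ i ∈ Finset.range k, structPoly q (weightD q (n - (i + 1 : ℕ)))) •
        LaurentPolynomial.T (n - k) := by
  induction k with
  | zero => simp
  | succ k ih =>
    rw [pow_succ', map_mul, Module.End.mul_apply, ih, map_smul, laurentRep_lb_T,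
      Finset.prod_range_succ, smul_smul, Nat.cast_succ, sub_sub]

theorem laurentRep_evalOmegaD_T_zero (p : ℂ[X][X]) :
    laurentRep hq (evalOmegaD hq p) (LaurentPolynomial.T 0) = p • LaurentPolynomial.T 0 := by
  induction p using Polynomial.induction_on' with
  | add p r hp hr => rw [map_add, map_add, LinearMap.add_apply, hp, hr, add_smul]
  | monomial n p =>
    rw [← C_mul_X_pow_eq_monomial, map_mul, map_mul, Module.End.mul_apply, map_pow, evalOmegaD_X,
      laurentRep_ld_pow_T, weightD_zero, laurentRep_evalOmegaD_C, map_smul, mul_smul, smul_comm]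
    rfl

include hq in
theorem structPoly_weightD_ne_zero (n : ℤ) : structPoly q (weightD q n) ≠ 0 := by
  intro h
  have := congrArg (fun p => eval 0 (eval 0 p)) h
  simp [structPoly, weightD, hq] at this

theorem exists_laurentRep_laurentMon (k : ℤ) : ∃ g : ℂ[X][X], g ≠ 0 ∧
    laurentRep hq (laurentMon q k) (LaurentPolynomial.T 0) = g • LaurentPolynomial.T k := by
  obtain ⟨n, rfl | rfl⟩ := k.eq_nat_or_neg
  · refine ⟨1, one_ne_zero, ?_⟩
    rw [laurentMon_natCast, laurentRep_lc_pow_T, zero_add, one_smul]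
  · refine ⟨_, ?_, by rw [laurentMon_neg_natCast, laurentRep_lb_pow_T, zero_sub]⟩
    exact Finset.prod_ne_zero_iff.mpr fun i _ => structPoly_weightD_ne_zero hq _

/-- The orbit map at the cyclic vector `1` of the representation. -/
def cyclicMap : Lspec q →+ LaurentOmegaD where
  toFun u := laurentRep hq u (LaurentPolynomial.T 0)
  map_zero' := by rw [map_zero, LinearMap.zero_apply]
  map_add' u v := by rw [map_add, LinearMap.add_apply]

theorem cyclicMap_apply (u : Lspec q) :
    cyclicMap hq u = laurentRep hq u (LaurentPolynomial.T 0) := rfl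

theorem cyclicMap_injective : Function.Injective (cyclicMap hq) := by
  choose g hg0 hg using exists_laurentRep_laurentMon hq
  have key (f : ℤ →₀ ℂ[X][X]) (k : ℤ) :
      laurentBasis.repr (cyclicMap hq (normalForm hq f)) k = f k * g k := by
    induction f using Finsupp.induction_linear with
    | zero => simp
    | add f f' hf hf' => simp [hf, hf', add_mul]
    | single n p =>
      rw [normalForm_single, cyclicMap_apply, map_mul, Module.End.mul_apply,
        laurentRep_evalOmegaD_T_zero, map_smul, hg, smul_smul, ← laurentBasis_apply, map_smul,
        Module.Basis.repr_self]
      obtain rfl | h := eq_or_ne n k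
      · simp
      · simp [Finsupp.single_eq_of_ne h.symm]
  refine (injective_iff_map_eq_zero _).mpr fun u hu => ?_
  obtain ⟨f, rfl⟩ := normalForm_surjective hq u
  suffices f = 0 by rw [this, map_zero]
  ext1 k
  have := key f k
  rw [hu, map_zero, Finsupp.zero_apply, eq_comm, mul_eq_zero] at this
  exact this.resolve_right (hg0 k)

end Faithful

/-! ### The center at a root of unity -/

section CenterMap

variable {q : ℂ} (hq : q ≠ 0)

theorem laurentRep_lc (v : LaurentOmegaD) :
    laurentRep hq (lc q) v = LaurentPolynomial.T 1 * v := by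
  have : laurentRep hq (lc q) = LinearMap.mulLeft ℂ[X][X] (LaurentPolynomial.T 1) :=
    end_ext fun n => by
      rw [laurentRep_lc_T, LinearMap.mulLeft_apply, ← LaurentPolynomial.T_add, add_comm]
  rw [this, LinearMap.mulLeft_apply]

theorem laurentRep_of_mem_center {z : Lspec q} (hz : z ∈ Subring.center (Lspec q))
    (v : LaurentOmegaD) : laurentRep hq z v = v * cyclicMap hq z := by
  have hsucc (v : LaurentOmegaD) : laurentRep hq z (LaurentPolynomial.T 1 * v) =
      LaurentPolynomial.T 1 * laurentRep hq z v := by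
    rw [← laurentRep_lc hq, ← laurentRep_lc hq, ← Module.End.mul_apply, ← Module.End.mul_apply,
      ← map_mul, ← map_mul, Subring.mem_center_iff.mp hz]
  have : laurentRep hq z = LinearMap.mulRight ℂ[X][X] (cyclicMap hq z) := by
    refine end_ext fun n => ?_
    rw [LinearMap.mulRight_apply]
    induction n with
    | zero => rw [LaurentPolynomial.T_zero, one_mul, cyclicMap_apply, LaurentPolynomial.T_zero]
    | succ n ih => rw [add_comm, LaurentPolynomial.T_add, hsucc, ih, mul_assoc]
    | pred n ih =>
      have h : (LaurentPolynomial.T (-n) : LaurentOmegaD) =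
          LaurentPolynomial.T 1 * LaurentPolynomial.T (-n - 1) := by
        rw [← LaurentPolynomial.T_add, add_sub_cancel]
      rw [h, hsucc, mul_assoc] at ih
      exact (LaurentPolynomial.isUnit_T 1).mul_left_cancel ih
  rw [this, LinearMap.mulRight_apply]

/-- The restriction of the orbit map to the center. -/
def centerMap : Subring.center (Lspec q) →+* LaurentOmegaD where
  toFun z := cyclicMap hq z
  map_zero' := map_zero _
  map_add' _ _ := map_add _ _ _
  map_one' := by
    rw [OneMemClass.coe_one, cyclicMap_apply, map_one, Module.End.one_apply,
      LaurentPolynomial.T_zero]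
  map_mul' z u := by
    rw [mul_comm z u, Subring.coe_mul, cyclicMap_apply, map_mul, Module.End.mul_apply,
      ← cyclicMap_apply, laurentRep_of_mem_center hq u.2]

theorem centerMap_injective : Function.Injective (centerMap hq) :=
  (cyclicMap_injective hq).comp Subtype.val_injective

include hq in
theorem isDomain_center : IsDomain (Subring.center (Lspec q)) :=
  (centerMap_injective hq).isDomain (centerMap hq)

end CenterMap

section Powers

variable {q : ℂ} (hq : q ≠ 0) {l : ℕ} (hl : (q ^ 2) ^ l = 1)

include hq hl

theorem weightD_add_natCast (n : ℤ) : weightD q (n + l) = weightD q n := by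
  rw [weightD, zpow_add₀ (inv_ne_zero (pow_ne_zero 2 hq)), zpow_natCast, inv_pow _ l, hl, inv_one,
    mul_one, weightD]

theorem lc_pow_mem_center : lc q ^ l ∈ Subring.center (Lspec q) := by
  refine mem_center_of_commute' hq ?_ ((Commute.refl _).pow_left _) ?_
  · refine cyclicMap_injective hq ?_
    rw [cyclicMap_apply, cyclicMap_apply, map_mul, map_mul, Module.End.mul_apply,
      Module.End.mul_apply, laurentRep_lc_pow_T, laurentRep_lb_T, laurentRep_lb_T, map_smul,
      laurentRep_lc_pow_T, ← weightD_add_natCast hq hl (0 - 1), sub_add_eq_add_sub]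
  · have := mul_pow_of_mul_eq_smul (ld_mul_lc hq) l
    rw [inv_pow, hl, inv_one, one_smul] at this
    exact this.symm

theorem ld_pow_mem_center : ld q ^ l ∈ Subring.center (Lspec q) := by
  refine mem_center_of_commute' hq ?_ ?_ ((Commute.refl _).pow_left _)
  · have h : lb q * ld q = (q ^ 2)⁻¹ • (ld q * lb q) := by
      rw [ld_mul_lb, smul_smul, inv_mul_cancel₀ (pow_ne_zero 2 hq), one_smul]
    have := mul_pow_of_mul_eq_smul h l
    rw [inv_pow, hl, inv_one, one_smul] at this
    exact this.symm
  · have := mul_pow_of_mul_eq_smul (lc_mul_ld (q := q)) l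
    rw [hl, one_smul] at this
    exact this.symm

theorem lb_pow_mem_center : lb q ^ l ∈ Subring.center (Lspec q) := by
  refine mem_center_of_commute' hq ((Commute.refl _).pow_left _) ?_ ?_
  · refine cyclicMap_injective hq ?_
    rw [cyclicMap_apply, cyclicMap_apply, map_mul, map_mul, Module.End.mul_apply,
      Module.End.mul_apply, laurentRep_lc_T, laurentRep_lb_pow_T, laurentRep_lb_pow_T, map_smul,
      laurentRep_lc_T, sub_add_eq_add_sub]
    refine congrArg (· • _) (mul_right_cancel₀ (structPoly_weightD_ne_zero hq 0) ?_)
    have h0 := weightD_add_natCast hq hl (-l)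
    rw [neg_add_cancel] at h0
    have h1 := Finset.prod_range_succ (fun i : ℕ => structPoly q (weightD q (-i))) l
    rw [Finset.prod_range_succ', ← h0] at h1
    simpa [neg_add_eq_sub] using h1.symm
  · have := mul_pow_of_mul_eq_smul (ld_mul_lb (q := q)) l
    rw [hl, one_smul] at this
    exact this.symm

end Powers

section Average

variable {A : Type*} [Ring A] [Algebra ℂ A]

/-- The sum `∑ xᵐ u xˡ⁻ᵐ` over `m < l`. -/
def twistedSum (x : A) (l : ℕ) : A →+ A where
  toFun u := ∑ m ∈ Finset.range l, x ^ m * u * x ^ (l - m)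
  map_zero' := by simp
  map_add' u v := by simp [mul_add, add_mul, Finset.sum_add_distrib]

theorem twistedSum_of_mul_eq_smul {x u : A} {z : ℂ} (h : x * u = z • (u * x)) (l : ℕ) :
    twistedSum x l u = (∑ m ∈ Finset.range l, z ^ m) • (u * x ^ l) := by
  have hm (m : ℕ) : x ^ m * u = z ^ m • (u * x ^ m) := by
    induction m with
    | zero => simp
    | succ m ih =>
      rw [pow_succ', mul_assoc, ih, mul_smul_comm, ← mul_assoc, h, smul_mul_assoc, smul_smul,
        mul_assoc, ← pow_succ', ← pow_succ]
  rw [Finset.sum_smul, twistedSum, AddMonoidHom.coe_mk, ZeroHom.coe_mk]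
  refine Finset.sum_congr rfl fun m hml => ?_
  rw [hm, smul_mul_assoc, mul_assoc, ← pow_add,
    Nat.add_sub_cancel' (Finset.mem_range.mp hml).le]

theorem twistedSum_eq_zero {x u : A} {z : ℂ} (h : x * u = z • (u * x)) {l : ℕ} (hl : z ^ l = 1)
    (hz : z ≠ 1) : twistedSum x l u = 0 := by
  rw [twistedSum_of_mul_eq_smul h, geom_sum_eq hz, hl, sub_self, zero_div, zero_smul]

theorem twistedSum_of_commute {x u : A} (h : x * u = u * x) (l : ℕ) :
    twistedSum x l u = (l : ℂ) • (u * x ^ l) := by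
  rw [twistedSum_of_mul_eq_smul (z := 1) (by rw [h, one_smul])]
  simp

end Average

section Generation

variable {q : ℂ} (hq : q ≠ 0) {l : ℕ} (hl : IsPrimitiveRoot (q ^ 2) l)

/-- The subalgebra generated by `ω` and the `l`-th powers of `b, c, d`. -/
def powersAlgebra (q : ℂ) (l : ℕ) : Subalgebra ℂ (Lspec q) :=
  Algebra.adjoin ℂ {omegaL q, lb q ^ l, lc q ^ l, ld q ^ l}

include hq hl

theorem powersAlgebra_le_center {u : Lspec q} (hu : u ∈ powersAlgebra q l) :
    u ∈ Subring.center (Lspec q) := by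
  have : powersAlgebra q l ≤ Subalgebra.center ℂ (Lspec q) := by
    refine Algebra.adjoin_le ?_
    rintro _ (rfl | rfl | rfl | rfl)
    exacts [omegaL_mem_center hq, lb_pow_mem_center hq hl.pow_eq_one,
      lc_pow_mem_center hq hl.pow_eq_one, ld_pow_mem_center hq hl.pow_eq_one]
  exact this hu

omit hq in
theorem laurentMon_mem_powersAlgebra {k : ℤ} (hk : (q ^ 2)⁻¹ ^ k = 1) :
    laurentMon q k ∈ powersAlgebra q l := by
  have hdvd := (hl.inv.zpow_eq_one_iff_dvd k).mp hk
  obtain ⟨n, rfl | rfl⟩ := k.eq_nat_or_neg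
  · obtain ⟨m, rfl⟩ := Int.natCast_dvd_natCast.mp hdvd
    rw [laurentMon_natCast, pow_mul]
    exact pow_mem (Algebra.subset_adjoin (by simp)) m
  · obtain ⟨m, rfl⟩ := Int.natCast_dvd_natCast.mp ((dvd_neg).mp hdvd)
    rw [laurentMon_neg_natCast, pow_mul]
    exact pow_mem (Algebra.subset_adjoin (by simp)) m

omit hq hl in
theorem aeval_omegaL_mem_powersAlgebra (p : ℂ[X]) : aeval (omegaL q) p ∈ powersAlgebra q l :=
  Algebra.adjoin_mono (by simp) (aeval_mem_adjoin_singleton ℂ (omegaL q) (p := p))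

theorem twistedSum_twistedSum_monomial (k : ℤ) (p : ℂ[X]) (n : ℕ) :
    ∃ y ∈ powersAlgebra q l,
      twistedSum (lc q) l (twistedSum (ld q) l (laurentMon q k * (aeval (omegaL q) p * ld q ^ n)))
        = y * (ld q ^ l * lc q ^ l) := by
  have hp : aeval (omegaL q) p ∈ Subring.center (Lspec q) :=
    powersAlgebra_le_center hq hl (aeval_omegaL_mem_powersAlgebra p)
  set w := laurentMon q k * (aeval (omegaL q) p * ld q ^ n) with hw
  have hd : ld q * w = (q ^ 2)⁻¹ ^ k • (w * ld q) := by
    rw [hw, ← mul_assoc, ld_mul_laurentMon hq, smul_mul_assoc, mul_assoc, ← mul_assoc (ld q),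
      Subring.mem_center_iff.mp hp, mul_assoc, ← pow_succ', pow_succ (ld q)]
    simp only [mul_assoc]
  by_cases hk : (q ^ 2)⁻¹ ^ k = 1
  · have hmon := laurentMon_mem_powersAlgebra hl hk
    have hc : lc q * (w * ld q ^ l) = (q ^ 2) ^ n • (w * ld q ^ l * lc q) := by
      have h1 := Subring.mem_center_iff.mp (powersAlgebra_le_center hq hl hmon)
      have h2 := Subring.mem_center_iff.mp (ld_pow_mem_center hq hl.pow_eq_one)
      rw [hw, ← mul_assoc, ← mul_assoc, h1, mul_assoc (laurentMon q k), ← mul_assoc (lc q),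
        Subring.mem_center_iff.mp hp, mul_assoc (aeval (omegaL q) p),
        mul_pow_of_mul_eq_smul lc_mul_ld, mul_assoc _ _ (lc q), ← h2]
      simp only [mul_assoc, mul_smul_comm, smul_mul_assoc]
    have hs : twistedSum (ld q) l w = (l : ℂ) • (w * ld q ^ l) :=
      twistedSum_of_commute (by rw [hd, hk, one_smul]) l
    have hc' : lc q * twistedSum (ld q) l w = (q ^ 2) ^ n • (twistedSum (ld q) l w * lc q) := by
      rw [hs, mul_smul_comm, hc, smul_mul_assoc, smul_comm]
    by_cases hn : (q ^ 2) ^ n = 1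
    · obtain ⟨m, rfl⟩ := (hl.pow_eq_one_iff_dvd n).mp hn
      refine ⟨(l : ℂ) • (l : ℂ) • w, Subalgebra.smul_mem _ (Subalgebra.smul_mem _ ?_ _) _, ?_⟩
      · rw [hw, pow_mul]
        exact mul_mem hmon (mul_mem (aeval_omegaL_mem_powersAlgebra p)
          (pow_mem (Algebra.subset_adjoin (by simp)) m))
      · rw [twistedSum_of_commute (by rw [hc', hn, one_smul]), hs]
        simp only [smul_mul_assoc, mul_assoc]
    · refine ⟨0, zero_mem _, ?_⟩
      rw [twistedSum_eq_zero hc' _ hn, zero_mul]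
      rw [← pow_mul, mul_comm, pow_mul, hl.pow_eq_one, one_pow]
  · refine ⟨0, zero_mem _, ?_⟩
    rw [twistedSum_eq_zero hd _ hk, map_zero, zero_mul]
    rw [← zpow_natCast, ← zpow_mul, mul_comm, zpow_mul, zpow_natCast, inv_pow, hl.pow_eq_one,
      inv_one, one_zpow]

theorem twistedSum_twistedSum_eq (u : Lspec q) : ∃ y ∈ powersAlgebra q l,
    twistedSum (lc q) l (twistedSum (ld q) l u) = y * (ld q ^ l * lc q ^ l) := by
  obtain ⟨f, rfl⟩ := normalForm_surjective hq u
  induction f using Finsupp.induction_linear with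
  | zero => exact ⟨0, zero_mem _, by simp⟩
  | add f g hf hg =>
    obtain ⟨y, hy, hfy⟩ := hf
    obtain ⟨y', hy', hgy⟩ := hg
    exact ⟨y + y', add_mem hy hy', by rw [map_add, map_add, map_add, hfy, hgy, add_mul]⟩
  | single k p =>
    rw [normalForm_single]
    induction p using Polynomial.induction_on' with
    | add p r hp hr =>
      obtain ⟨y, hy, hpy⟩ := hp
      obtain ⟨y', hy', hry⟩ := hr
      exact ⟨y + y', add_mem hy hy',
        by rw [map_add, mul_add, map_add, map_add, hpy, hry, add_mul]⟩
    | monomial n p =>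
      rw [← C_mul_X_pow_eq_monomial, map_mul (evalOmegaD hq), map_pow, evalOmegaD_X,
        evalOmegaD_C]
      exact twistedSum_twistedSum_monomial hq hl k p n

omit hl in
theorem ld_pow_mul_lc_pow_ne_zero : ld q ^ l * lc q ^ l ≠ 0 := by
  intro h
  have := congrArg (cyclicMap hq) h
  rw [cyclicMap_apply, map_mul, Module.End.mul_apply, laurentRep_lc_pow_T, laurentRep_ld_pow_T,
    map_zero, ← laurentBasis_apply] at this
  have := congrArg (fun v => laurentBasis.repr v (0 + l)) this
  simp [weightD, hq] at this

theorem mem_powersAlgebra_of_mem_center (hl0 : l ≠ 0) {z : Lspec q}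
    (hz : z ∈ Subring.center (Lspec q)) : z ∈ powersAlgebra q l := by
  obtain ⟨y, hy, h⟩ := twistedSum_twistedSum_eq hq hl z
  have hz' := Subring.mem_center_iff.mp hz
  have hd := ld_pow_mem_center hq hl.pow_eq_one
  have hc := lc_pow_mem_center hq hl.pow_eq_one
  rw [twistedSum_of_commute (hz' _), twistedSum_of_commute] at h
  · have hne : (⟨_, mul_mem hd hc⟩ : Subring.center (Lspec q)) ≠ 0 := fun h =>
      ld_pow_mul_lc_pow_ne_zero hq (congrArg Subtype.val h)
    have := isDomain_center hq
    have key : (algebraMap ℂ (Subring.center (Lspec q)) (l * l) * ⟨z, hz⟩) * ⟨_, mul_mem hd hc⟩ =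
        ⟨y, powersAlgebra_le_center hq hl hy⟩ * ⟨_, mul_mem hd hc⟩ := by
      refine Subtype.ext ?_
      refine Eq.trans ?_ h
      change (algebraMap ℂ (Lspec q) (l * l) * z) * (ld q ^ l * lc q ^ l) = _
      rw [← Algebra.smul_def, mul_smul]
      simp only [smul_mul_assoc, mul_assoc]
    have := congrArg Subtype.val (mul_right_cancel₀ hne key)
    change algebraMap ℂ (Lspec q) (l * l) * z = y at this
    have hz2 : z = ((l * l : ℂ)⁻¹) • y := by
      rw [← this, ← Algebra.smul_def, smul_smul, inv_mul_cancel₀, one_smul]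
      exact mul_self_ne_zero.mpr (Nat.cast_ne_zero.mpr hl0)
    rw [hz2]
    exact Subalgebra.smul_mem _ hy _
  · rw [mul_smul_comm, smul_mul_assoc, ← mul_assoc, hz', mul_assoc, mul_assoc,
      Subring.mem_center_iff.mp hd]

end Generation

/-! ### Frobenius-type substitution and independence -/

section Independence

variable {q : ℂ} (hq : q ≠ 0) {l : ℕ}

theorem eval_eval_structPoly (hq : q ≠ 0) {u : ℂ} (hu : u ≠ 0) (x : ℂ) (d : ℂ[X]) :
    eval (u + u⁻¹) (eval d (structPoly q (x • X))) = -(q ^ 4)⁻¹ *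
      ((q * u - x * d.eval (u + u⁻¹)) * (q * u⁻¹ - x * d.eval (u + u⁻¹))) := by
  simp [structPoly]
  field_simp
  ring

theorem prod_structPoly (hq : IsPrimitiveRoot q l) (hq2 : IsPrimitiveRoot (q ^ 2) l) (hodd : Odd l)
    {p : ℂ[X]} (hp : ∀ u : ℂ, u ≠ 0 → p.eval (u + u⁻¹) = u ^ l + u⁻¹ ^ l) :
    ∏ i ∈ Finset.range l, structPoly q (weightD q (0 - (i + 1 : ℕ))) =
      X ^ l * (C p - X ^ l) - 1 := by
  have hq0 := hq.ne_zero hodd.pos.ne'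
  have hprod (x d : ℂ) :
      ∏ i ∈ Finset.range l, (q * x - (q ^ 2) ^ (i + 1) * d) = x ^ l - d ^ l := by
    have h := congrArg (eval (q * x)) (X_pow_sub_C_eq_prod hq2 hodd.pos (α := q ^ 2 * d) rfl)
    simp only [eval_sub, eval_pow, eval_X, eval_C, eval_prod, mul_pow, hq.pow_eq_one,
      hq2.pow_eq_one, one_mul] at h
    rw [h]
    exact Finset.prod_congr rfl fun i _ => by ring
  refine Polynomial.funext fun d => Polynomial.funext fun x => ?_
  obtain ⟨u, hu, rfl⟩ := exists_add_inv_eq x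
  rw [eval_prod, eval_prod]
  have hw (i : ℕ) : weightD q (0 - (i + 1 : ℕ)) = (q ^ 2) ^ (i + 1) • X := by
    rw [weightD, zero_sub, zpow_neg, zpow_natCast, inv_pow, inv_inv]
  simp only [hw, eval_eval_structPoly hq0 hu]
  rw [Finset.prod_mul_distrib, Finset.prod_mul_distrib, hprod, hprod, Finset.prod_const,
    Finset.card_range, hodd.neg_pow, inv_pow, ← pow_mul, mul_comm 4, pow_mul, hq.pow_eq_one]
  have h1 : u ^ l * u⁻¹ ^ l = 1 := by rw [← mul_pow, mul_inv_cancel₀ hu, one_pow]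
  simp only [eval_sub, eval_mul, eval_pow, eval_X, eval_C, eval_one, hp u hu]
  linear_combination -h1

/-- The coefficientwise substitution `ω ↦ p(ω)` on `LaurentOmegaD`. -/
def substOmega (p : ℂ[X]) : LaurentOmegaD →+* LaurentOmegaD :=
  AddMonoidAlgebra.mapRingHom ℤ (mapRingHom (compRingHom p))

theorem repr_substOmega (p : ℂ[X]) (v : LaurentOmegaD) (n : ℤ) :
    laurentBasis.repr (substOmega p v) n = (laurentBasis.repr v n).map (compRingHom p) :=
  AddMonoidAlgebra.coeff_mapRingHom ..

theorem substOmega_smul_T (p : ℂ[X]) (r : ℂ[X][X]) (n : ℤ) :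
    substOmega p (r • LaurentPolynomial.T n) =
      r.map (compRingHom p) • LaurentPolynomial.T n := by
  refine laurentBasis.repr.injective (Finsupp.ext fun m => ?_)
  rw [repr_substOmega, map_smul, map_smul, ← laurentBasis_apply, Module.Basis.repr_self]
  obtain rfl | h := eq_or_ne n m
  · simp
  · simp [Finsupp.single_eq_of_ne h.symm]

theorem eq_zero_of_sum_smul_substOmega {p : ℂ[X]} (hl : 0 < l) (hp : p.natDegree = l)
    (v : ℕ → LaurentOmegaD)
    (h : ∑ i ∈ Finset.range l, (C X ^ i : ℂ[X][X]) • substOmega p (v i) = 0) :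
    ∀ i < l, v i = 0 := by
  intro i hi
  refine laurentBasis.repr.injective (Finsupp.ext fun n => Polynomial.ext fun m => ?_)
  rw [map_zero, Finsupp.zero_apply, coeff_zero]
  refine eq_zero_of_sum_comp_mul_X_pow hl hp
    (fun i => (laurentBasis.repr (v i) n).coeff m) ?_ i hi
  have := congrArg (fun v => (laurentBasis.repr v n).coeff m) h
  simpa only [map_sum, map_smul, map_zero, Finsupp.finsetSum_apply, Finsupp.smul_apply,
    repr_substOmega, ← C_pow, smul_eq_mul, finsetSum_coeff, coeff_C_mul, coeff_map,
    coe_compRingHom_apply, Finsupp.zero_apply, coeff_zero, mul_comm] using this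

end Independence

/-! ### The extension of centers -/

section Extension

variable {q : ℂ} (hq : q ≠ 0) {l : ℕ}

theorem aeval_int_omegaL (P : ℤ[X]) :
    aeval (omegaL q) P = evalOmegaD hq (C (P.map (Int.castRingHom ℂ))) := by
  rw [evalOmegaD_C, aeval_def, aeval_def, eval₂_map]
  congr 1

theorem cyclicMap_omegaL_pow_mul (i : ℕ) {z : Lspec q} (hz : z ∈ Subring.center (Lspec q)) :
    cyclicMap hq (z * omegaL q ^ i) = (C X ^ i : ℂ[X][X]) • cyclicMap hq z := by
  have h : omegaL q ^ i = evalOmegaD hq (C (X ^ i)) := by rw [evalOmegaD_C, map_pow, aeval_X]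
  rw [← Subring.mem_center_iff.mp hz, cyclicMap_apply, map_mul, Module.End.mul_apply, h,
    laurentRep_evalOmegaD_C, cyclicMap_apply, C_pow]
  rfl

theorem cyclicMap_algebraMap (z : ℂ) :
    cyclicMap hq (algebraMap ℂ (Lspec q) z) = (C (C z) : ℂ[X][X]) • LaurentPolynomial.T 0 := by
  rw [cyclicMap_apply, AlgHom.commutes, Module.algebraMap_end_apply, complex_smul_laurent]

variable (hε : IsPrimitiveRoot q l) (hε2 : IsPrimitiveRoot (q ^ 2) l) (hodd : Odd l) {P : ℤ[X]}
  (hP : ∀ u : ℂ, u ≠ 0 → aeval (u + u⁻¹) P = u ^ l + u⁻¹ ^ l)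

include hq hε2 in
theorem sub_ld_pow_mem_center : aeval (omegaL q) P - ld q ^ l ∈ Subring.center (Lspec q) := by
  refine sub_mem ?_ (ld_pow_mem_center hq hε2.pow_eq_one)
  rw [aeval_int_omegaL hq, evalOmegaD_C]
  exact powersAlgebra_le_center hq hε2 (aeval_omegaL_mem_powersAlgebra _)

include hε hε2 hodd hP

theorem cyclicMap_generator_mem_range {x : Lspec q}
    (hx : x ∈ ({aeval (omegaL q) P - ld q ^ l, lb q ^ l, lc q ^ l, ld q ^ l} : Set (Lspec q))) :
    cyclicMap hq x ∈ (substOmega (P.map (Int.castRingHom ℂ))).rangeS := by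
  rcases hx with rfl | rfl | rfl | rfl
  · refine ⟨(C X - X ^ l : ℂ[X][X]) • LaurentPolynomial.T 0, ?_⟩
    rw [substOmega_smul_T, aeval_int_omegaL hq, ← evalOmegaD_X hq, ← map_pow, ← map_sub,
      cyclicMap_apply, laurentRep_evalOmegaD_T_zero]
    simp
  · refine ⟨(X ^ l * (C X - X ^ l) - 1 : ℂ[X][X]) • LaurentPolynomial.T (0 - l), ?_⟩
    rw [substOmega_smul_T, cyclicMap_apply, laurentRep_lb_pow_T, prod_structPoly hε hε2 hodd
      (p := P.map (Int.castRingHom ℂ))]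
    · simp
    · intro u hu
      rw [← hP u hu, eval_map, aeval_def]
      rfl
  · refine ⟨(1 : ℂ[X][X]) • LaurentPolynomial.T (0 + l), ?_⟩
    rw [substOmega_smul_T, cyclicMap_apply, laurentRep_lc_pow_T, Polynomial.map_one, one_smul]
  · refine ⟨(X ^ l : ℂ[X][X]) • LaurentPolynomial.T 0, ?_⟩
    rw [substOmega_smul_T, cyclicMap_apply, laurentRep_ld_pow_T, weightD_zero, Polynomial.map_pow,
      map_X]

variable (h1 : aeval (omegaL q) P - ld q ^ l ∈ Subring.center (Lspec q))
  (h2 : lb q ^ l ∈ Subring.center (Lspec q)) (h3 : lc q ^ l ∈ Subring.center (Lspec q))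
  (h4 : ld q ^ l ∈ Subring.center (Lspec q))

theorem centerMap_mem_range {z : Subring.center (Lspec q)}
    (hz : z ∈ Z0inC q ⟨_, h1⟩ ⟨_, h2⟩ ⟨_, h3⟩ ⟨_, h4⟩) :
    centerMap hq z ∈ (substOmega (P.map (Int.castRingHom ℂ))).rangeS := by
  induction hz using Algebra.adjoin_induction with
  | mem x hx =>
    refine cyclicMap_generator_mem_range hq hε hε2 hodd hP ?_
    rcases hx with rfl | rfl | rfl | rfl <;> simp
  | algebraMap z =>
    refine ⟨(C (C z) : ℂ[X][X]) • LaurentPolynomial.T 0, ?_⟩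
    rw [substOmega_smul_T]
    refine Eq.trans ?_ (cyclicMap_algebraMap hq z).symm
    simp
  | add x y _ _ hx hy => rw [map_add]; exact add_mem hx hy
  | mul x y _ _ hx hy => rw [map_mul]; exact mul_mem hx hy

theorem linearIndependent_omegaL_pow :
    LinearIndependent (Z0inC q ⟨_, h1⟩ ⟨_, h2⟩ ⟨_, h3⟩ ⟨_, h4⟩)
      (fun i : Fin l => (⟨_, omegaL_mem_center hq⟩ : Subring.center (Lspec q)) ^ (i : ℕ)) := by
  obtain ⟨-, hdeg⟩ := map_monic_of_eval_add_inv l hodd.pos P hP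
  rw [Fintype.linearIndependent_iff]
  intro g hg i
  choose v hv using fun i => centerMap_mem_range hq hε hε2 hodd hP h1 h2 h3 h4 (g i).2
  have hsum : ∑ i : Fin l, (C X ^ (i : ℕ) : ℂ[X][X]) •
      substOmega (P.map (Int.castRingHom ℂ)) (v i) = 0 := by
    have := congrArg (centerMap hq) hg
    rw [map_sum, map_zero] at this
    rw [← this]
    refine Finset.sum_congr rfl fun i _ => ?_
    rw [hv]
    exact (cyclicMap_omegaL_pow_mul hq i (g i).1.2).symm
  have := eq_zero_of_sum_smul_substOmega hodd.pos hdeg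
    (fun i => if h : i < l then v ⟨i, h⟩ else 0) ?_ i i.2
  · rw [dif_pos i.2] at this
    have hi := hv i
    rw [this, map_zero, eq_comm] at hi
    exact Subtype.ext ((map_eq_zero_iff _ (centerMap_injective hq)).mp hi)
  · rw [Finset.sum_range, ← hsum]
    exact Finset.sum_congr rfl fun i _ => by rw [dif_pos i.2]

omit hε hP in
theorem adjoin_omegaL_eq_top :
    Algebra.adjoin (Z0inC q ⟨_, h1⟩ ⟨_, h2⟩ ⟨_, h3⟩ ⟨_, h4⟩)
      {(⟨_, omegaL_mem_center hq⟩ : Subring.center (Lspec q))} = ⊤ := by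
  set Z := Z0inC q ⟨_, h1⟩ ⟨_, h2⟩ ⟨_, h3⟩ ⟨_, h4⟩ with hZ
  refine eq_top_iff.mpr fun z _ => ?_
  have hZ' {x : Subring.center (Lspec q)} (hx : x ∈ Z) :
      x ∈ Algebra.adjoin Z {(⟨_, omegaL_mem_center hq⟩ : Subring.center (Lspec q))} :=
    Subalgebra.algebraMap_mem _ (⟨x, hx⟩ : Z)
  have key (u : Lspec q) (hu : u ∈ powersAlgebra q l) : ∃ h : u ∈ Subring.center (Lspec q),
      ⟨u, h⟩ ∈ Algebra.adjoin Z {(⟨_, omegaL_mem_center hq⟩ : Subring.center (Lspec q))} := by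
    induction hu using Algebra.adjoin_induction with
    | mem x hx =>
      rcases hx with rfl | rfl | rfl | rfl
      · exact ⟨omegaL_mem_center hq, Algebra.subset_adjoin rfl⟩
      · exact ⟨h2, hZ' (Algebra.subset_adjoin (by simp))⟩
      · exact ⟨h3, hZ' (Algebra.subset_adjoin (by simp))⟩
      · exact ⟨h4, hZ' (Algebra.subset_adjoin (by simp))⟩
    | algebraMap z =>
      exact ⟨(algebraMap ℂ (Subring.center (Lspec q)) z).2, hZ' (Subalgebra.algebraMap_mem Z z)⟩
    | add x y _ _ hx hy =>
      obtain ⟨hx, hx'⟩ := hx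
      obtain ⟨hy, hy'⟩ := hy
      exact ⟨add_mem hx hy, add_mem hx' hy'⟩
    | mul x y _ _ hx hy =>
      obtain ⟨hx, hx'⟩ := hx
      obtain ⟨hy, hy'⟩ := hy
      exact ⟨mul_mem hx hy, mul_mem hx' hy'⟩
  exact (key z (mem_powersAlgebra_of_mem_center hq hε2 hodd.pos.ne' z.2)).2

omit hε hε2 in
theorem exists_monic_aeval_omegaL_eq_zero :
    ∃ r : Polynomial (Z0inC q ⟨_, h1⟩ ⟨_, h2⟩ ⟨_, h3⟩ ⟨_, h4⟩), r.Monic ∧ r.natDegree = l ∧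
      aeval (⟨_, omegaL_mem_center hq⟩ : Subring.center (Lspec q)) r = 0 := by
  obtain ⟨hmonic, hdeg⟩ := map_monic_of_eval_add_inv l hodd.pos P hP
  set Z := Z0inC q ⟨_, h1⟩ ⟨_, h2⟩ ⟨_, h3⟩ ⟨_, h4⟩ with hZ
  have := isDomain_center hq
  have hm : (P.map (Int.castRingHom Z)).Monic ∧ (P.map (Int.castRingHom Z)).natDegree = l := by
    rw [show Int.castRingHom Z = (algebraMap ℂ Z).comp (Int.castRingHom ℂ) from
      RingHom.ext_int _ _, ← Polynomial.map_map]
    exact ⟨hmonic.map _, by rw [hmonic.natDegree_map, hdeg]⟩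
  let s : Z := ⟨⟨_, h1⟩, Algebra.subset_adjoin (by simp)⟩ +
    ⟨⟨_, h4⟩, Algebra.subset_adjoin (by simp)⟩
  refine ⟨P.map (Int.castRingHom Z) - C s, hm.1.sub_of_left ?_, ?_, ?_⟩
  · refine degree_C_le.trans_lt ?_
    rw [degree_eq_natDegree hm.1.ne_zero, hm.2]
    exact_mod_cast hodd.pos
  · rw [natDegree_sub_C, hm.2]
  · rw [map_sub, aeval_C, aeval_def, eval₂_map]
    refine Subtype.ext ?_
    change Subring.subtype _ (eval₂ _ _ P) - (aeval (omegaL q) P - ld q ^ l + ld q ^ l) = 0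
    rw [hom_eval₂, sub_add_cancel, sub_eq_zero, aeval_def]
    congr 1

end Extension

end PolynomialModel

/-- Let `l ≥ 3` be odd, `ε` a primitive `l`-th root of unity, `T_l` the rescaled
Chebyshev polynomial of the first kind, and `Z₀` the unital ℂ-subalgebra of 𝓛(ε) generated by
`T_l(ω) − dˡ, bˡ, cˡ, dˡ`.  Then `Z₀` and the center `Z` of 𝓛(ε) are integral domains with
`Z₀ ⊆ Z`, and the embedding of fraction fields `Q(Z₀) → Q(Z)` induced by this inclusion makes
`Q(Z)` a field extension of `Q(Z₀)` of degree exactly `l`.  (The four generators of `Z₀` are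
asserted to be central; `Z₀` is then also realized as the ℂ-subalgebra of `Z` generated by the
same four elements, and the induced embedding `f : Q(Z₀) → Q(Z)` is the unique ring
homomorphism compatible with the inclusion `Z₀ ⊆ Z`.) -/
theorem stmt_11 (l : ℕ) (hodd : Odd l) (hl : 3 ≤ l) (ε : ℂ) (hε : IsPrimitiveRoot ε l)
    (P : Polynomial ℤ)
    (hP : ∀ u : ℂ, u ≠ 0 → Polynomial.aeval (u + u⁻¹) P = u ^ l + u⁻¹ ^ l) :
    ∃ (h1 : Polynomial.aeval (omegaL ε) P - ld ε ^ l ∈ Subring.center (Lspec ε))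
      (h2 : lb ε ^ l ∈ Subring.center (Lspec ε))
      (h3 : lc ε ^ l ∈ Subring.center (Lspec ε))
      (h4 : ld ε ^ l ∈ Subring.center (Lspec ε)),
      ((Algebra.adjoin ℂ {Polynomial.aeval (omegaL ε) P - ld ε ^ l,
          lb ε ^ l, lc ε ^ l, ld ε ^ l} : Subalgebra ℂ (Lspec ε)) : Set (Lspec ε)) ⊆
        (Subring.center (Lspec ε) : Set (Lspec ε)) ∧
      IsDomain (Algebra.adjoin ℂ {Polynomial.aeval (omegaL ε) P - ld ε ^ l,
          lb ε ^ l, lc ε ^ l, ld ε ^ l} : Subalgebra ℂ (Lspec ε)) ∧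
      IsDomain (Subring.center (Lspec ε)) ∧
      -- the degree of the induced extension of fraction fields is exactly `l`:
      ∃ f : FractionRing (Z0inC ε ⟨_, h1⟩ ⟨_, h2⟩ ⟨_, h3⟩ ⟨_, h4⟩) →+*
            FractionRing (Subring.center (Lspec ε)),
        f.comp (algebraMap _ _) =
          (algebraMap (Subring.center (Lspec ε))
              (FractionRing (Subring.center (Lspec ε)))).comp
            ((Z0inC ε ⟨_, h1⟩ ⟨_, h2⟩ ⟨_, h3⟩ ⟨_, h4⟩).val).toRingHom ∧
        @Module.finrank (FractionRing (Z0inC ε ⟨_, h1⟩ ⟨_, h2⟩ ⟨_, h3⟩ ⟨_, h4⟩))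
          (FractionRing (Subring.center (Lspec ε))) _ _
          (Module.compHom _ f) = l := by
  have hε0 : ε ≠ 0 := hε.ne_zero (by omega)
  have hε2 : IsPrimitiveRoot (ε ^ 2) l :=
    hε.pow_of_coprime 2 (Nat.coprime_two_left.mpr hodd)
  have h1 := sub_ld_pow_mem_center hε0 hε2 (P := P)
  have h2 := lb_pow_mem_center hε0 hε2.pow_eq_one
  have h3 := lc_pow_mem_center hε0 hε2.pow_eq_one
  have h4 := ld_pow_mem_center hε0 hε2.pow_eq_one
  have hle : Algebra.adjoin ℂ {Polynomial.aeval (omegaL ε) P - ld ε ^ l,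
      lb ε ^ l, lc ε ^ l, ld ε ^ l} ≤ Subalgebra.center ℂ (Lspec ε) := by
    refine Algebra.adjoin_le ?_
    rintro _ (rfl | rfl | rfl | rfl)
    exacts [h1, h2, h3, h4]
  have hdom := isDomain_center hε0
  refine ⟨h1, h2, h3, h4, hle, ?_, hdom, ?_⟩
  · have : IsDomain (Subalgebra.center ℂ (Lspec ε)) := hdom
    exact (Subalgebra.inclusion_injective hle).isDomain (Subalgebra.inclusion hle).toRingHom
  · obtain ⟨r, hr, hrd, hr0⟩ := exists_monic_aeval_omegaL_eq_zero hε0 hodd hP h1 h2 h3 h4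
    exact exists_finrank_fractionRing_eq l ⟨_, omegaL_mem_center hε0⟩
      (linearIndependent_omegaL_pow hε0 hε hε2 hodd hP h1 h2 h3 h4)
      (top_le_span_pow_of_monic l hodd.pos _ r hr hrd hr0
        (adjoin_omegaL_eq_top hε0 hε2 hodd h1 h2 h3 h4))

end
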